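/- Variation independence of the marginals P(Y(x_0)) and P(Y(x_1)): Suppose the observed conditional laws p_z(x, y) = P(X = x, Y = y | Z = z), z ∈ {1,…,K}, arise from some model satisfying assumption (i) with instrument law π (π(z) > 0 for all z). Then for every pair (a, b) with 1 − g(0, 0) ≤ a ≤ g(0, 1) and 1 − g(1, 0) ≤ b ≤ g(1, 1), there exists a model — random variables Z, X(z_1),…,X(z_K), Y(x_0), Y(x_1) on some probability space satisfying assumption (i), with Z having law π and P(X = x, Y = y | Z = z) = p_z(x, y) for all x, y, z — in which P(Y(x_0) = 1) = a and P(Y(x_1) = 1) = b. -/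

import Mathlib

open MeasureTheory ProbabilityTheory

/-- The bound `g(i, j)` of Theorem 2, expressed in terms of conditional laws
`p z x y` (interpreted as `P(X = x, Y = y | Z = z)`):
`g(i,j) = min{ min_z [ p_z(X=i,Y=j) + p_z(X=1−i) ],`
`min_{z ≠ z̃} [ p_z(X=i,Y=j) + p_z(X=1−i,Y=0) + p_{z̃}(X=i,Y=j) + p_{z̃}(X=1−i,Y=1) ] }`,
where `p_z(X = 1−i) = p_z(X=1−i, Y=0) + p_z(X=1−i, Y=1)`. -/
noncomputable def gOf {K : ℕ} (hK : 2 ≤ K) (p : Fin K → Fin 2 → Fin 2 → ℝ)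
    (i j : Fin 2) : ℝ :=
  min
    ((Finset.univ : Finset (Fin K)).inf'
      ⟨⟨0, by omega⟩, Finset.mem_univ _⟩
      (fun z => p z i j + (p z (1 - i) 0 + p z (1 - i) 1)))
    (((Finset.univ : Finset (Fin K × Fin K)).filter (fun q => q.1 ≠ q.2)).inf'
      ⟨(⟨0, by omega⟩, ⟨1, by omega⟩), by
        simp only [Finset.mem_filter, Finset.mem_univ, true_and]
        exact fun h => absurd (congrArg Fin.val h) (by simp)⟩
      (fun q => p q.1 i j + p q.1 (1 - i) 0 + p q.2 i j + p q.2 (1 - i) 1))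

/-- A binary instrumental-variable model with instrument law `π` and observed conditional
laws `p z x y = P(X = x, Y = y | Z = z)`, satisfying assumption (i): joint independence of
`Z` from `(Y(x₀), Y(x₁), X(z₁), …, X(z_K))`.  The observed treatment is `X = X(Z)` and the
observed outcome is `Y = Y(X)`. -/
structure IVModel (K : ℕ) (π : Fin K → ℝ) (p : Fin K → Fin 2 → Fin 2 → ℝ) where
  (Ω : Type)
  [m : MeasurableSpace Ω]
  (P : Measure Ω)
  prob : IsProbabilityMeasure P
  Z : Ω → Fin K
  Xz : Fin K → Ω → Fin 2
  Y0 : Ω → Fin 2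
  Y1 : Ω → Fin 2
  hZ : Measurable Z
  hXz : ∀ z, Measurable (Xz z)
  hY0 : Measurable Y0
  hY1 : Measurable Y1
  indep : IndepFun Z (fun ω => (Y0 ω, Y1 ω, fun z => Xz z ω)) P
  law_Z : ∀ z, (P (Z ⁻¹' {z})).toReal = π z
  law_cond : ∀ (z : Fin K) (x y : Fin 2),
    (P[|Z ⁻¹' {z}] {ω | Xz (Z ω) ω = x ∧
      (if Xz (Z ω) ω = 0 then Y0 ω else Y1 ω) = y}).toReal = p z x y

/-- One-dimensional Helly: a real between four lower and four upper bounds. -/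
lemma exists_between4 (l1 l2 l3 l4 u1 u2 u3 u4 : ℝ)
    (h : (l1 ≤ u1 ∧ l1 ≤ u2 ∧ l1 ≤ u3 ∧ l1 ≤ u4) ∧ (l2 ≤ u1 ∧ l2 ≤ u2 ∧ l2 ≤ u3 ∧ l2 ≤ u4) ∧
      (l3 ≤ u1 ∧ l3 ≤ u2 ∧ l3 ≤ u3 ∧ l3 ≤ u4) ∧ (l4 ≤ u1 ∧ l4 ≤ u2 ∧ l4 ≤ u3 ∧ l4 ≤ u4)) :
    ∃ s, (l1 ≤ s ∧ l2 ≤ s ∧ l3 ≤ s ∧ l4 ≤ s) ∧ s ≤ u1 ∧ s ≤ u2 ∧ s ≤ u3 ∧ s ≤ u4 := by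
  refine ⟨max (max l1 l2) (max l3 l4), ⟨by simp, by simp, by simp, by simp⟩, ?_⟩
  simp only [max_le_iff]
  tauto

/-- Splitting the joint law `q` of the potential outcomes so as to match `p`. -/
lemma exists_split (q p : Fin 2 → Fin 2 → ℝ) (hq : ∀ i j, 0 ≤ q i j) (hp : ∀ i j, 0 ≤ p i j)
    (hq1 : q 0 0 + q 0 1 + q 1 0 + q 1 1 = 1) (hp1 : p 0 0 + p 0 1 + p 1 0 + p 1 1 = 1)
    (h0 : ∀ i, p 0 i ≤ q i 0 + q i 1) (h1 : ∀ j, p 1 j ≤ q 0 j + q 1 j)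
    (hb : ∀ i j, q i j ≤ p 0 i + p 1 j) :
    ∃ r : Fin 2 → Fin 2 → ℝ, (∀ i j, 0 ≤ r i j) ∧ (∀ i j, r i j ≤ q i j) ∧
      (∀ i, r i 0 + r i 1 = p 0 i) ∧ (∀ j, (q 0 j - r 0 j) + (q 1 j - r 1 j) = p 1 j) := by
  simp only [Fin.forall_fin_two] at *
  obtain ⟨s, hs⟩ := exists_between4 0 (p 0 1 - q 1 0) (q 0 1 + q 1 1 - p 1 1 - q 0 1)
    (q 0 1 + q 1 1 - p 1 1 - p 0 0) (q 1 1) (p 0 1) (q 0 1 + q 1 1 - p 1 1)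
    (q 0 0 - p 0 0 + (q 0 1 + q 1 1 - p 1 1)) (by
      refine ⟨⟨?_, ?_, ?_, ?_⟩, ⟨?_, ?_, ?_, ?_⟩, ⟨?_, ?_, ?_, ?_⟩, ⟨?_, ?_, ?_, ?_⟩⟩ <;> linarith)
  refine ⟨fun i j => if i = 0 then (if j = 0 then p 0 0 - (q 0 1 + q 1 1 - p 1 1) + s
      else q 0 1 + q 1 1 - p 1 1 - s) else (if j = 0 then p 0 1 - s else s), ?_⟩
  simp
  refine ⟨⟨⟨?_, ?_⟩, ?_, ?_⟩, ⟨⟨?_, ?_⟩, ?_, ?_⟩, ?_, ?_⟩ <;> linarith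

/-- The set of `(y, u)` under the graph of `q`. -/
noncomputable def outcomeLaw (q : Fin 2 → Fin 2 → ℝ) : Measure ((Fin 2 × Fin 2) × ℝ) :=
  ∑ y : Fin 2 × Fin 2, Measure.map (fun u => (y, u)) (volume.restrict (Set.Ico 0 (q y.1 y.2)))

lemma outcomeLaw_apply (q : Fin 2 → Fin 2 → ℝ) (A : Set ((Fin 2 × Fin 2) × ℝ))
    (hA : MeasurableSet A) :
    outcomeLaw q A = ∑ y : Fin 2 × Fin 2,
      volume ({u | (y, u) ∈ A} ∩ Set.Ico 0 (q y.1 y.2)) := by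
  unfold outcomeLaw
  rw [Measure.finsetSum_apply]
  refine Finset.sum_congr rfl fun y _ => ?_
  have hm : Measurable (fun u : ℝ => (y, u)) := by fun_prop
  rw [Measure.map_apply hm hA, Measure.restrict_apply (hm hA)]
  rfl

/-- The law of the instrument. -/
noncomputable def instrLaw {K : ℕ} (π : Fin K → ℝ) : Measure (Fin K) :=
  ∑ z, ENNReal.ofReal (π z) • Measure.dirac z

lemma instrLaw_singleton {K : ℕ} (π : Fin K → ℝ) (z : Fin K) :
    instrLaw π {z} = ENNReal.ofReal (π z) := by
  unfold instrLaw
  rw [Measure.finsetSum_apply, Finset.sum_eq_single z]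
  · simp
  · intro b _ hb
    simp [hb]
  · simp

lemma instrLaw_univ {K : ℕ} (π : Fin K → ℝ) (h : ∀ z, 0 ≤ π z) (h1 : ∑ z, π z = 1) :
    instrLaw π Set.univ = 1 := by
  unfold instrLaw
  rw [Measure.finsetSum_apply]
  simp [← ENNReal.ofReal_sum_of_nonneg (fun i _ => h i), h1]

lemma model_sums {K : ℕ} {π : Fin K → ℝ} (hπpos : ∀ z, 0 < π z)
    {p : Fin K → Fin 2 → Fin 2 → ℝ} (M : IVModel K π p) :
    (∑ z, π z = 1) ∧ (∀ z x y, 0 ≤ p z x y) ∧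
      ∀ z, p z 0 0 + p z 0 1 + p z 1 0 + p z 1 1 = 1 := by
  obtain ⟨Ω, P, prob, Z, Xz, Y0, Y1, hZ, hXz, hY0, hY1, indep, law_Z, law_cond⟩ := M
  refine ⟨?_, fun z x y => by rw [← law_cond]; exact ENNReal.toReal_nonneg, fun z => ?_⟩
  · have := sum_measureReal_preimage_singleton (μ := P) (Finset.univ : Finset (Fin K)) (f := Z)
      (fun y _ => hZ (measurableSet_singleton y))
    simp only [measureReal_def, law_Z] at this
    simpa using this
  · have hne : P (Z ⁻¹' {z}) ≠ 0 := by
      intro h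
      have := law_Z z
      rw [h] at this
      simp at this
      exact (hπpos z).ne this
    have hc : IsProbabilityMeasure (P[|Z ⁻¹' {z}]) := cond_isProbabilityMeasure hne
    have hX : Measurable (fun ω => Xz (Z ω) ω) := by
      have h2 : Measurable (fun w : Fin K × Ω => Xz w.1 w.2) :=
        measurable_from_prod_countable_right hXz
      exact h2.comp (hZ.prodMk measurable_id)
    have hY : Measurable (fun ω => if Xz (Z ω) ω = 0 then Y0 ω else Y1 ω) :=
      Measurable.ite (hX (measurableSet_singleton 0)) hY0 hY1
    have hW := hX.prodMk hY
    have := sum_measureReal_preimage_singleton (μ := P[|Z ⁻¹' {z}])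
      (Finset.univ : Finset (Fin 2 × Fin 2)) (fun y _ => hW (measurableSet_singleton y))
    have e : ∀ x y, (P[|Z ⁻¹' {z}]).real ((fun ω => (Xz (Z ω) ω,
        if Xz (Z ω) ω = 0 then Y0 ω else Y1 ω)) ⁻¹' {(x, y)}) = p z x y := by
      intro x y
      rw [← law_cond z x y, measureReal_def]
      congr 2
      ext ω
      simp
    simp only [Fintype.sum_prod_type, Fin.sum_univ_two, e] at this
    simp at this
    linarith

lemma build {K : ℕ} {π : Fin K → ℝ} (hπpos : ∀ z, 0 < π z) (hπ : ∑ z, π z = 1)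
    {p : Fin K → Fin 2 → Fin 2 → ℝ} (q : Fin 2 → Fin 2 → ℝ) (r : Fin K → Fin 2 → Fin 2 → ℝ)
    (hq1 : q 0 0 + q 0 1 + q 1 0 + q 1 1 = 1)
    (hr0 : ∀ z i j, 0 ≤ r z i j) (hrq : ∀ z i j, r z i j ≤ q i j)
    (hp0 : ∀ z i, r z i 0 + r z i 1 = p z 0 i)
    (hp1 : ∀ z j, (q 0 j - r z 0 j) + (q 1 j - r z 1 j) = p z 1 j)
    (hq : ∀ i j, 0 ≤ q i j) :
    ∃ M : IVModel K π p, (M.P {ω | M.Y0 ω = 1}).toReal = q 1 0 + q 1 1 ∧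
      (M.P {ω | M.Y1 ω = 1}).toReal = q 0 1 + q 1 1 := by
  classical
  have hνu := instrLaw_univ π (fun z => (hπpos z).le) hπ
  have hμu : outcomeLaw q Set.univ = 1 := by
    rw [outcomeLaw_apply _ _ MeasurableSet.univ]
    simp only [Fintype.sum_prod_type, Fin.sum_univ_two, Set.mem_univ, Set.ofPred_true,
      Set.univ_inter, Real.volume_Ico, sub_zero]
    rw [← ENNReal.ofReal_add (hq _ _) (hq _ _), ← ENNReal.ofReal_add (hq _ _) (hq _ _),
      ← ENNReal.ofReal_add (add_nonneg (hq _ _) (hq _ _)) (add_nonneg (hq _ _) (hq _ _)),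
      ← add_assoc, hq1]
    simp
  have i1 : IsProbabilityMeasure (instrLaw π) := ⟨hνu⟩
  have i2 : IsProbabilityMeasure (outcomeLaw q) := ⟨hμu⟩
  let X : Fin K → ((Fin 2 × Fin 2) × ℝ) → Fin 2 := fun z w => if w.2 < r z w.1.1 w.1.2 then 0 else 1
  have hX : ∀ z, Measurable (X z) := fun z => by
    refine Measurable.ite (measurableSet_lt measurable_snd ?_) measurable_const measurable_const
    exact (measurable_of_countable (fun y : Fin 2 × Fin 2 => r z y.1 y.2)).comp measurable_fst
  have hlow : ∀ z i j, volume ({u : ℝ | u < r z i j} ∩ Set.Ico 0 (q i j))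
      = ENNReal.ofReal (r z i j) := by
    intro z i j
    have : {u : ℝ | u < r z i j} ∩ Set.Ico 0 (q i j) = Set.Ico 0 (r z i j) := by
      ext u
      have := hrq z i j
      simp only [Set.mem_inter_iff, Set.mem_ofPred_eq, Set.mem_Ico]
      constructor
      · rintro ⟨h1, h2, h3⟩; exact ⟨h2, h1⟩
      · rintro ⟨h1, h2⟩; exact ⟨h2, h1, by linarith⟩
    rw [this]; simp
  have hhigh : ∀ z i j, volume ({u : ℝ | r z i j ≤ u} ∩ Set.Ico 0 (q i j))
      = ENNReal.ofReal (q i j - r z i j) := by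
    intro z i j
    have : {u : ℝ | r z i j ≤ u} ∩ Set.Ico 0 (q i j) = Set.Ico (r z i j) (q i j) := by
      ext u
      have := hr0 z i j
      simp only [Set.mem_inter_iff, Set.mem_ofPred_eq, Set.mem_Ico]
      constructor
      · rintro ⟨h1, h2, h3⟩; exact ⟨h1, h3⟩
      · rintro ⟨h1, h2⟩; exact ⟨h1, by linarith, h2⟩
    rw [this]; simp
  have hcell : ∀ z x y, outcomeLaw q {w | X z w = x ∧ (if X z w = 0 then w.1.1 else w.1.2) = y}
      = ENNReal.ofReal (p z x y) := by
    intro z x y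
    have hm : Measurable (fun w => (X z w, if X z w = 0 then w.1.1 else w.1.2)) :=
      (hX z).prodMk (Measurable.ite (hX z (measurableSet_singleton 0))
        (by fun_prop) (by fun_prop))
    have hms : MeasurableSet {w | X z w = x ∧ (if X z w = 0 then w.1.1 else w.1.2) = y} := by
      have := hm (measurableSet_singleton (x, y))
      convert this using 1
      ext w
      simp
    rw [outcomeLaw_apply _ _ hms]
    have hd : ∀ i j, 0 ≤ q i j - r z i j := fun i j => sub_nonneg.2 (hrq z i j)
    have key : ∀ i j, volume ({u : ℝ | ((i, j), u) ∈ {w : (Fin 2 × Fin 2) × ℝ |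
        X z w = x ∧ (if X z w = 0 then w.1.1 else w.1.2) = y}} ∩ Set.Ico 0 (q i j)) =
        if x = 0 then (if i = y then ENNReal.ofReal (r z i j) else 0)
        else (if j = y then ENNReal.ofReal (q i j - r z i j) else 0) := by
      intro i j
      rw [← hlow, ← hhigh]
      have hx : x = 0 ∨ x = 1 := by fin_cases x <;> simp
      rcases hx with rfl | rfl
      · by_cases hy : i = y
        · simp only [hy, if_true]
          congr 2
          ext u
          by_cases hu : u < r z y j <;> simp [X, hu]
        · simp only [hy, if_true, if_false]
          convert measure_empty (μ := (volume : Measure ℝ))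
          ext u
          by_cases hu : u < r z i j <;> simp [X, hu, hy]
      · by_cases hy : j = y
        · simp only [hy, if_true, one_ne_zero, if_false]
          congr 2
          ext u
          by_cases hu : u < r z i y
          · simp [X, hu]
          · simp [X, hu, not_lt.1 hu]
        · simp only [hy, if_false, one_ne_zero]
          convert measure_empty (μ := (volume : Measure ℝ))
          ext u
          by_cases hu : u < r z i j <;> simp [X, hu, hy]
    simp only [Fintype.sum_prod_type, Fin.sum_univ_two, key]
    fin_cases x <;> fin_cases y <;>
      simp [← hp0, ← hp1, ENNReal.ofReal_add, hr0, hd]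
  have hmarg0 : outcomeLaw q {w | w.1.1 = 1} = ENNReal.ofReal (q 1 0 + q 1 1) := by
    have hm : Measurable (fun w : (Fin 2 × Fin 2) × ℝ => w.1.1) := by fun_prop
    have hs : MeasurableSet {w : (Fin 2 × Fin 2) × ℝ | w.1.1 = 1} := hm (measurableSet_singleton 1)
    rw [outcomeLaw_apply _ _ hs]
    simp [Fintype.sum_prod_type, Fin.sum_univ_two, ENNReal.ofReal_add, hq]
  have hmarg1 : outcomeLaw q {w | w.1.2 = 1} = ENNReal.ofReal (q 0 1 + q 1 1) := by
    have hm : Measurable (fun w : (Fin 2 × Fin 2) × ℝ => w.1.2) := by fun_prop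
    have hs : MeasurableSet {w : (Fin 2 × Fin 2) × ℝ | w.1.2 = 1} := hm (measurableSet_singleton 1)
    rw [outcomeLaw_apply _ _ hs]
    simp [Fintype.sum_prod_type, Fin.sum_univ_two, ENNReal.ofReal_add, hq]
  have hppos : ∀ z x y, 0 ≤ p z x y := by
    intro z x y
    have hx : x = 0 ∨ x = 1 := by fin_cases x <;> simp
    rcases hx with rfl | rfl
    · rw [← hp0]; exact add_nonneg (hr0 _ _ _) (hr0 _ _ _)
    · rw [← hp1]; exact add_nonneg (sub_nonneg.2 (hrq _ _ _)) (sub_nonneg.2 (hrq _ _ _))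
  let P : Measure (Fin K × ((Fin 2 × Fin 2) × ℝ)) := (instrLaw π).prod (outcomeLaw q)
  have hP1 : ∀ z, P (Prod.fst ⁻¹' {z}) = ENNReal.ofReal (π z) := by
    intro z
    have : (Prod.fst ⁻¹' {z} : Set (Fin K × ((Fin 2 × Fin 2) × ℝ))) = {z} ×ˢ Set.univ := by
      ext w; simp
    simp only [P]
    rw [this, Measure.prod_prod, instrLaw_singleton, hμu, mul_one]
  have hP2 : ∀ A : Set ((Fin 2 × Fin 2) × ℝ), P {w | w.2 ∈ A} = outcomeLaw q A := by
    intro A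
    have : {w : Fin K × ((Fin 2 × Fin 2) × ℝ) | w.2 ∈ A} = Set.univ ×ˢ A := by
      ext w; simp
    simp only [P]
    rw [this, Measure.prod_prod, hνu, one_mul]
  let M : IVModel K π p :=
    { Ω := Fin K × ((Fin 2 × Fin 2) × ℝ)
      P := P
      prob := by infer_instance
      Z := Prod.fst
      Xz := fun z w => X z w.2
      Y0 := fun w => w.2.1.1
      Y1 := fun w => w.2.1.2
      hZ := measurable_fst
      hXz := fun z => (hX z).comp measurable_snd
      hY0 := by fun_prop
      hY1 := by fun_prop
      indep := by
        have := indepFun_prod (μ := instrLaw π) (ν := outcomeLaw q)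
          (X := fun z : Fin K => z)
          (Y := fun w => (w.1.1, w.1.2, fun z => X z w)) measurable_id
          (by
            refine Measurable.prodMk (by fun_prop) (Measurable.prodMk (by fun_prop) ?_)
            exact measurable_pi_lambda _ hX)
        exact this
      law_Z := fun z => by rw [hP1, ENNReal.toReal_ofReal (hπpos z).le]
      law_cond := fun z x y => by
        rw [cond_apply (measurable_fst (measurableSet_singleton z)), hP1]
        have : (Prod.fst ⁻¹' {z} ∩ {ω : Fin K × ((Fin 2 × Fin 2) × ℝ) | X ω.1 ω.2 = x ∧
            (if X ω.1 ω.2 = 0 then ω.2.1.1 else ω.2.1.2) = y}) =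
            {z} ×ˢ {w | X z w = x ∧ (if X z w = 0 then w.1.1 else w.1.2) = y} := by
          ext ⟨z', w⟩
          simp only [Set.mem_inter_iff, Set.mem_preimage, Set.mem_singleton_iff,
            Set.mem_ofPred_eq, Set.mem_prod]
          constructor
          · rintro ⟨rfl, h⟩; exact ⟨rfl, h⟩
          · rintro ⟨rfl, h⟩; exact ⟨rfl, h⟩
        rw [this]
        simp only [P]
        rw [Measure.prod_prod, instrLaw_singleton, hcell, ← mul_assoc, ENNReal.inv_mul_cancel,
          one_mul, ENNReal.toReal_ofReal (hppos z x y)]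
        · simpa using hπpos z
        · simp }
  refine ⟨M, ?_, ?_⟩
  · have : P {ω | ω.2.1.1 = 1} = _ := (hP2 {w | w.1.1 = 1}).trans hmarg0
    change (P {ω | ω.2.1.1 = 1}).toReal = _
    rw [this, ENNReal.toReal_ofReal (add_nonneg (hq _ _) (hq _ _))]
  · have : P {ω | ω.2.1.2 = 1} = _ := (hP2 {w | w.1.2 = 1}).trans hmarg1
    change (P {ω | ω.2.1.2 = 1}).toReal = _
    rw [this, ENNReal.toReal_ofReal (add_nonneg (hq _ _) (hq _ _))]

lemma gOf_le_one {K : ℕ} (hK : 2 ≤ K) (p : Fin K → Fin 2 → Fin 2 → ℝ) (i j : Fin 2) (z : Fin K) :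
    gOf hK p i j ≤ p z i j + (p z (1 - i) 0 + p z (1 - i) 1) :=
  (min_le_left _ _).trans (Finset.inf'_le _ (Finset.mem_univ z))

lemma gOf_le_two {K : ℕ} (hK : 2 ≤ K) (p : Fin K → Fin 2 → Fin 2 → ℝ) (hp : ∀ z x y, 0 ≤ p z x y)
    (i j : Fin 2) (z z' : Fin K) :
    gOf hK p i j ≤ p z i j + p z (1 - i) 0 + p z' i j + p z' (1 - i) 1 := by
  by_cases h : z = z'
  · subst h
    have := gOf_le_one hK p i j z
    have := hp z i j
    linarith
  · exact (min_le_right _ _).trans (Finset.inf'_le (fun q : Fin K × Fin K =>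
      p q.1 i j + p q.1 (1 - i) 0 + p q.2 i j + p q.2 (1 - i) 1)
      (b := (z, z')) (by simpa using h))

/-- variation independence of the marginals `P(Y(x₀))` and `P(Y(x₁))`: if the
observed conditional laws `p z` arise from some model satisfying assumption (i) with
instrument law `π` (positive everywhere), then for every pair `(a, b)` with
`1 − g(0,0) ≤ a ≤ g(0,1)` and `1 − g(1,0) ≤ b ≤ g(1,1)` there exists a model — with the
same instrument law `π` and the same observed conditional laws `p`, satisfying assumption
(i) — in which `P(Y(x₀) = 1) = a` and `P(Y(x₁) = 1) = b`. -/
theorem stmt9 (K : ℕ) (hK : 2 ≤ K)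
    (π : Fin K → ℝ) (hπpos : ∀ z, 0 < π z)
    (p : Fin K → Fin 2 → Fin 2 → ℝ)
    (hmodel : Nonempty (IVModel K π p)) :
    ∀ a b : ℝ,
      1 - gOf hK p 0 0 ≤ a → a ≤ gOf hK p 0 1 →
      1 - gOf hK p 1 0 ≤ b → b ≤ gOf hK p 1 1 →
      ∃ M : IVModel K π p,
        (M.P {ω | M.Y0 ω = 1}).toReal = a ∧ (M.P {ω | M.Y1 ω = 1}).toReal = b := by
  intro a b ha1 ha2 hb1 hb2
  obtain ⟨M0⟩ := hmodel
  obtain ⟨hπ, hp, hps⟩ := model_sums hπpos M0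
  have A1 := fun z => gOf_le_one hK p 0 0 z
  have A2 := fun z => gOf_le_one hK p 0 1 z
  have B1 := fun z => gOf_le_one hK p 1 0 z
  have B2 := fun z => gOf_le_one hK p 1 1 z
  have A3 := fun z z' => gOf_le_two hK p hp 0 0 z z'
  have A4 := fun z z' => gOf_le_two hK p hp 0 1 z z'
  have B3 := fun z z' => gOf_le_two hK p hp 1 0 z z'
  have B4 := fun z z' => gOf_le_two hK p hp 1 1 z z'
  simp only [sub_zero, sub_self] at A1 A2 B1 B2 A3 A4 B3 B4
  haveI : Nonempty (Fin K) := ⟨⟨0, by omega⟩⟩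
  have hmin : ∀ i j, ∃ z0, ∀ z, p z0 0 i + p z0 1 j ≤ p z 0 i + p z 1 j := fun i j =>
    Finite.exists_min (fun z => p z 0 i + p z 1 j)
  obtain ⟨z00, h00⟩ := hmin 0 0
  obtain ⟨z01, h01⟩ := hmin 0 1
  obtain ⟨z10, h10⟩ := hmin 1 0
  obtain ⟨z11, h11⟩ := hmin 1 1
  have F : ∀ z, p z 0 1 ≤ a ∧ a ≤ 1 - p z 0 0 ∧ p z 1 1 ≤ b ∧ b ≤ 1 - p z 1 0 ∧
      0 ≤ p z 0 0 ∧ 0 ≤ p z 0 1 ∧ 0 ≤ p z 1 0 ∧ 0 ≤ p z 1 1 := fun z => by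
    have := A1 z; have := A2 z; have := B1 z; have := B2 z; have := hps z
    refine ⟨?_, ?_, ?_, ?_, hp _ _ _, hp _ _ _, hp _ _ _, hp _ _ _⟩ <;> linarith
  obtain ⟨t, ht⟩ := exists_between4 0 (a + b - 1) (a - (p z10 0 1 + p z10 1 0))
    (b - (p z01 0 0 + p z01 1 1)) a b (p z11 0 1 + p z11 1 1)
    (p z00 0 0 + p z00 1 0 + a + b - 1) (by
      have := F z00; have := F z01; have := F z10; have := F z11
      have := hps z00; have := hps z01; have := hps z10; have := hps z11
      have := A4 z10 z11
      have := A3 z00 z01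
      have := B3 z00 z10
      have := B4 z01 z11
      refine ⟨⟨?_, ?_, ?_, ?_⟩, ⟨?_, ?_, ?_, ?_⟩, ⟨?_, ?_, ?_, ?_⟩, ⟨?_, ?_, ?_, ?_⟩⟩ <;>
        linarith)
  let q : Fin 2 → Fin 2 → ℝ := fun i j =>
    if i = 0 then (if j = 0 then 1 - a - b + t else b - t) else (if j = 0 then a - t else t)
  have q00 : q 0 0 = 1 - a - b + t := by simp [q]
  have q01 : q 0 1 = b - t := by simp [q]
  have q10 : q 1 0 = a - t := by simp [q]
  have q11 : q 1 1 = t := by simp [q]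
  have hq1 : q 0 0 + q 0 1 + q 1 0 + q 1 1 = 1 := by rw [q00, q01, q10, q11]; ring
  have hq : ∀ i j, 0 ≤ q i j := by
    simp only [Fin.forall_fin_two, q00, q01, q10, q11]
    refine ⟨⟨?_, ?_⟩, ?_, ?_⟩ <;> linarith
  have hr := fun z => exists_split q (p z) hq (hp z) hq1 (hps z)
    (by
      have := F z; have := hps z
      simp only [Fin.forall_fin_two, q00, q01, q10, q11]
      refine ⟨?_, ?_⟩ <;> linarith)
    (by
      have := F z; have := hps z
      simp only [Fin.forall_fin_two, q00, q01, q10, q11]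
      refine ⟨?_, ?_⟩ <;> linarith)
    (by
      have := h00 z; have := h01 z; have := h10 z; have := h11 z
      simp only [Fin.forall_fin_two, q00, q01, q10, q11]
      refine ⟨⟨?_, ?_⟩, ?_, ?_⟩ <;> linarith)
  choose r hr0 hrq hp0 hp1 using hr
  obtain ⟨M, hM0, hM1⟩ := build hπpos hπ q r hq1 hr0 hrq hp0 hp1 hq
  refine ⟨M, ?_, ?_⟩
  · rw [hM0, q10, q11]; ring
  · rw [hM1, q01, q11]; ring
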